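/- arXiv:2110.00734 — 2 statements merged into one kernel-verified Lean document; each statement's English description precedes it below -/
import Mathlib

section
/- Let x̄ ∈ {0,1}^E be the indicator vector of a stable matching of the expanded instance Γ_{t̄}, where the expansion t̄ is given by a binary vector ȳ ∈ {0,1}^{C×{0,…,B}} with Σ_{k=0}^B ȳ_c^k = 1 and t̄_c = Σ_{k=0}^B k·ȳ_c^k. If ȳ_c^k = 1 for a school c ∈ C, then for every α with 0 < α < k and every comb Ĉ ∈ C_c(k−α) one has Σ_{(s,c')∈Ĉ} x̄_{s,c'} ≥ q_c; that is, all generalized-comb constraints for combs with expansion strictly smaller than k are satisfied by (x̄, ȳ). -/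
open scoped BigOperators

/-- An instance of the school choice problem: capacities, acceptability (feasible pairs),
strict student preferences over acceptable schools, and strict school priorities over
acceptable students. -/
structure SchoolInstance (S C : Type*) where
  /-- capacity of each school -/
  q : C → ℕ
  /-- `acc s c` means `(s,c) ∈ E`, i.e. school `c` is acceptable to student `s` -/
  acc : S → C → Prop
  /-- `sPref s c c'` means `c ≻_s c'` -/
  sPref : S → C → C → Prop
  /-- `cPref c s s'` means `s ≻_c s'` -/
  cPref : C → S → S → Prop
  sPref_irrefl : ∀ s c, ¬ sPref s c c
  sPref_trans : ∀ s c₁ c₂ c₃, sPref s c₁ c₂ → sPref s c₂ c₃ → sPref s c₁ c₃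
  sPref_total : ∀ s c₁ c₂, acc s c₁ → acc s c₂ → c₁ ≠ c₂ → sPref s c₁ c₂ ∨ sPref s c₂ c₁
  sPref_acc : ∀ s c₁ c₂, sPref s c₁ c₂ → acc s c₁ ∧ acc s c₂
  cPref_irrefl : ∀ c s, ¬ cPref c s s
  cPref_trans : ∀ c s₁ s₂ s₃, cPref c s₁ s₂ → cPref c s₂ s₃ → cPref c s₁ s₃
  cPref_total : ∀ c s₁ s₂, acc s₁ c → acc s₂ c → s₁ ≠ s₂ → cPref c s₁ s₂ ∨ cPref c s₂ s₁
  cPref_acc : ∀ c s₁ s₂, cPref c s₁ s₂ → acc s₁ c ∧ acc s₂ c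

namespace SchoolInstance

variable {S C : Type*} [Fintype S] [Fintype C]

/-- The expanded instance `Γ_t = ⟨S, C, ≻, q + t⟩`. -/
def expand (i : SchoolInstance S C) (t : C → ℕ) : SchoolInstance S C :=
  { i with q := fun c => i.q c + t c }

/-- Students assigned to school `c` under assignment `μ`. -/
def assignedSet (μ : S → Option C) (c : C) : Set S := {s | μ s = some c}

/-- `μ` is a matching: assignments are feasible pairs and capacities are respected. -/
def IsMatching (i : SchoolInstance S C) (μ : S → Option C) : Prop :=
  (∀ s c, μ s = some c → i.acc s c) ∧ ∀ c, (assignedSet μ c).ncard ≤ i.q c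

/-- Student `s` strictly prefers school `c` to the (possibly empty) assignment `o`. -/
def prefOver (i : SchoolInstance S C) (s : S) (c : C) : Option C → Prop
  | none => i.acc s c
  | some c' => i.sPref s c c'

/-- `(s,c)` is a blocking pair for `μ`. -/
def IsBlocking (i : SchoolInstance S C) (μ : S → Option C) (s : S) (c : C) : Prop :=
  i.acc s c ∧ i.prefOver s c (μ s) ∧
    ((assignedSet μ c).ncard < i.q c ∨ ∃ s', μ s' = some c ∧ i.cPref c s s')

/-- `μ` is a stable matching. -/
def IsStable (i : SchoolInstance S C) (μ : S → Option C) : Prop :=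
  i.IsMatching μ ∧ ∀ s c, ¬ i.IsBlocking μ s c

/-- Student `s` weakly prefers assignment `o` to assignment `o'`. -/
def weakPref (i : SchoolInstance S C) (s : S) (o o' : Option C) : Prop :=
  o = o' ∨ ∃ c, o = some c ∧ i.prefOver s c o'

/-- `μ` is the student-optimal stable matching: it is stable and every student weakly
prefers it to any other stable matching. -/
def IsStudentOptimal (i : SchoolInstance S C) (μ : S → Option C) : Prop :=
  i.IsStable μ ∧ ∀ μ', i.IsStable μ' → ∀ s, i.weakPref s (μ s) (μ' s)

/-- `rank i s c` is the rank `r_{s,c}` of school `c` in `≻_s` (1 = most preferred). -/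
noncomputable def rank (i : SchoolInstance S C) (s : S) (c : C) : ℕ :=
  1 + {c' | i.sPref s c' c}.ncard

end SchoolInstance

namespace SchoolInstance

variable {S C : Type*} [Fintype S] [Fintype C]

/-- The tooth `T(s,c)`: the pair `(s,c)` together with all pairs `(s,c')` with `c' ≻_s c`. -/
def tooth (i : SchoolInstance S C) (s : S) (c : C) : Set (S × C) :=
  insert (s, c) {p : S × C | p.1 = s ∧ i.sPref s p.2 c}

/-- The shaft `S^k(s,c)`: the pair `(s,c)` together with all pairs `(s',c)` with `s' ≻_c s`. -/
def shaft (i : SchoolInstance S C) (s : S) (c : C) : Set (S × C) :=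
  insert (s, c) {p : S × C | p.2 = c ∧ i.cPref c p.1 s}

/-- `A ∈ C_c(k)`: `A` is a comb of school `c` with expansion `k`, i.e. the union of a shaft
`S^k(s,c)` with base `(s,c) ∈ E_c^+(k)` and of exactly `q_c + k` teeth `T(s',c)` with
`(s',c)` in the shaft, one of which is `T(s,c)`. -/
def IsComb (i : SchoolInstance S C) (c : C) (k : ℕ) (A : Set (S × C)) : Prop :=
  ∃ s : S, i.acc s c ∧ i.q c + k - 1 ≤ {s' | i.cPref c s' s}.ncard ∧
    ∃ F : Finset S, (↑F : Set S) ⊆ {s' | (s', c) ∈ i.shaft s c} ∧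
      F.card = i.q c + k ∧ s ∈ F ∧
      A = i.shaft s c ∪ ⋃ s' ∈ F, i.tooth s' c

/-- The value `Σ_{(s,c')∈A} x_{s,c'}` of a set of pairs `A` at `x`. -/
noncomputable def combSum (x : S → Option C → ℝ) (A : Set (S × C)) : ℝ :=
  ∑ᶠ p ∈ A, x p.1 (some p.2)

/-- `(x,y) ∈ P^ext` for budget `B`, where `y_c^k` (for `k ∈ {0,…,B}`) is the unary
description of the capacity expansion of school `c`. -/
def inPext (i : SchoolInstance S C) (B : ℕ) (x : S → Option C → ℝ)
    (y : C → Fin (B + 1) → ℝ) : Prop :=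
  (∀ s c, ¬ i.acc s c → x s (some c) = 0) ∧
  (∀ s o, 0 ≤ x s o ∧ x s o ≤ 1) ∧
  (∀ c k, 0 ≤ y c k ∧ y c k ≤ 1) ∧
  (∀ s, x s none + ∑ᶠ c ∈ {c | i.acc s c}, x s (some c) = 1) ∧
  (∀ c, ∑ᶠ s ∈ {s | i.acc s c}, x s (some c)
      ≤ (i.q c : ℝ) + ∑ k : Fin (B + 1), ((k : ℕ) : ℝ) * y c k) ∧
  ((∑ c, ∑ k : Fin (B + 1), ((k : ℕ) : ℝ) * y c k) ≤ (B : ℝ)) ∧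
  (∀ c, ∑ k, y c k = 1)

/-- The objective `Σ_{(s,c)∈E} r_{s,c}·x_{s,c}` (the feasible pairs `E` include `(s,∅)`). -/
noncomputable def objX (i : SchoolInstance S C) (r : S → Option C → ℝ)
    (x : S → Option C → ℝ) : ℝ :=
  ∑ s, (r s none * x s none + ∑ᶠ c ∈ {c | i.acc s c}, r s (some c) * x s (some c))

end SchoolInstance

open SchoolInstance

namespace SchoolInstance

variable {S C : Type*}

/-- If every student of `G` is matched along a pair of `A`, then `A` has value at least `|G|`
at the indicator vector of the matching. -/
theorem ncard_le_combSum [Fintype S] [Fintype C] [DecidableEq C]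
    {μ : S → Option C} {x : S → Option C → ℝ}
    (hx : ∀ s o, x s o = if μ s = o then (1 : ℝ) else 0) {A : Set (S × C)} {G : Set S}
    (hG : ∀ s ∈ G, ∃ c, μ s = some c ∧ (s, c) ∈ A) :
    (G.ncard : ℝ) ≤ combSum x A := by
  classical
  have hsub : G ⊆ Prod.fst '' {p ∈ A | μ p.1 = some p.2} := fun s hs => by
    obtain ⟨c, hc, hA⟩ := hG s hs
    exact ⟨(s, c), ⟨hA, hc⟩, rfl⟩
  have hsum : combSum x A = ({p ∈ A | μ p.1 = some p.2} : Set (S × C)).ncard := by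
    rw [combSum, finsum_mem_eq_toFinset_sum, Set.ncard_eq_toFinset_card']
    simp only [hx, Finset.sum_boole]
    congr 2
    ext p
    simp
  rw [hsum]
  exact_mod_cast (Set.ncard_le_ncard hsub).trans (Set.ncard_image_le (Set.toFinite _))

/-- A student accepting `c` either is assigned along its tooth at `c` or strictly prefers `c` to its
assignment. -/
theorem exists_mem_tooth_or_prefOver {i : SchoolInstance S C} {μ : S → Option C}
    (hμ : i.IsMatching μ) {s : S} {c : C} (hs : i.acc s c) :
    (∃ c', μ s = some c' ∧ (s, c') ∈ i.tooth s c) ∨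
      (μ s ≠ some c ∧ i.prefOver s c (μ s)) := by
  rcases h : μ s with _ | c'
  · exact Or.inr ⟨by simp, hs⟩
  · rcases eq_or_ne c' c with rfl | hne
    · exact Or.inl ⟨c', rfl, Set.mem_insert _ _⟩
    · rcases i.sPref_total s c' c (hμ.1 s c' h) hs hne with h' | h'
      · exact Or.inl ⟨c', rfl, Set.mem_insert_of_mem _ ⟨rfl, h'⟩⟩
      · exact Or.inr ⟨by simpa using hne, h'⟩

/-- In a stable matching, a school that some student `s` strictly prefers to its assignment is
full, and all its students have higher priority than `s`. -/
theorem IsStable.full_of_prefOver {i : SchoolInstance S C} {μ : S → Option C}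
    (hμ : i.IsStable μ) {s : S} {c : C} (hs : i.acc s c) (hne : μ s ≠ some c)
    (hp : i.prefOver s c (μ s)) :
    i.q c ≤ (assignedSet μ c).ncard ∧ ∀ s', μ s' = some c → i.cPref c s' s := by
  refine ⟨?_, fun s' hs' => ?_⟩
  · by_contra! h
    exact hμ.2 s c ⟨hs, hp, Or.inl h⟩
  · have hss : s' ≠ s := by
      rintro rfl
      exact hne hs'
    exact (i.cPref_total c s' s (hμ.1.1 s' c hs') hs hss).resolve_right
      fun h => hμ.2 s c ⟨hs, hp, Or.inr ⟨s', hs', h⟩⟩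

theorem acc_of_mem_shaft {i : SchoolInstance S C} {s s' : S} {c : C} (hs : i.acc s c)
    (h : (s', c) ∈ i.shaft s c) : i.acc s' c := by
  rcases h with h | h
  · obtain rfl : s' = s := congrArg Prod.fst h
    exact hs
  · exact (i.cPref_acc c s' s h.2).1

theorem mem_shaft_of_cPref {i : SchoolInstance S C} {s s' s'' : S} {c : C}
    (h : (s', c) ∈ i.shaft s c) (h' : i.cPref c s'' s') : (s'', c) ∈ i.shaft s c := by
  rcases h with h | h
  · obtain rfl : s' = s := congrArg Prod.fst h
    exact Set.mem_insert_of_mem _ ⟨rfl, h'⟩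
  · exact Set.mem_insert_of_mem _ ⟨rfl, i.cPref_trans c _ _ _ h' h.2⟩

end SchoolInstance

/-- If `x̄` is the indicator vector of a stable matching of the expanded
instance `Γ_t̄` with `t̄` given by the binary vector `ȳ`, and `ȳ_c^k = 1`, then every
generalized-comb constraint of school `c` for combs with expansion `k − α`, `0 < α < k`, is
satisfied. -/
theorem comb_constraints_smaller_expansion_satisfied
    {S C : Type*} [Fintype S] [Fintype C] [DecidableEq C]
    (i : SchoolInstance S C) (B : ℕ)
    (ybar : C → Fin (B + 1) → ℝ)
    (hybin : ∀ c k, ybar c k = 0 ∨ ybar c k = 1)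
    (hysum : ∀ c, ∑ k, ybar c k = 1)
    (tbar : C → ℕ)
    (htbar : ∀ c, (tbar c : ℝ) = ∑ k : Fin (B + 1), ((k : ℕ) : ℝ) * ybar c k)
    (μ : S → Option C) (hμ : (i.expand tbar).IsStable μ)
    (xbar : S → Option C → ℝ)
    (hxbar : ∀ s o, xbar s o = if μ s = o then (1 : ℝ) else 0)
    (c : C) (k : Fin (B + 1)) (hy1 : ybar c k = 1)
    (α : ℕ) (hα : 0 < α) (hαk : α < (k : ℕ))
    (A : Set (S × C)) (hA : i.IsComb c ((k : ℕ) - α) A) :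
    (i.q c : ℝ) ≤ SchoolInstance.combSum xbar A := by
  obtain ⟨s, hs, -, F, hF, hcard, -, rfl⟩ := hA
  by_cases h : ∀ s' ∈ F, ∃ c', μ s' = some c' ∧ (s', c') ∈ i.tooth s' c
  · refine le_trans ?_ (ncard_le_combSum hxbar (G := (F : Set S)) fun s' hs' => ?_)
    · rw [Set.ncard_coe_finset, hcard]
      exact_mod_cast Nat.le_add_right _ _
    · obtain ⟨c', hc', ht⟩ := h s' hs'
      exact ⟨c', hc', Or.inr (Set.mem_biUnion hs' ht)⟩
  · push Not at h
    obtain ⟨s', hs', h⟩ := h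
    have hacc : (i.expand tbar).acc s' c := acc_of_mem_shaft hs (hF hs')
    obtain ⟨hne, hp⟩ := (exists_mem_tooth_or_prefOver hμ.1 hacc).resolve_left
      fun ⟨c', hc', ht⟩ => h c' hc' ht
    obtain ⟨hfull, hprio⟩ := hμ.full_of_prefOver hacc hne hp
    refine le_trans ?_ (ncard_le_combSum hxbar (G := assignedSet μ c) fun s'' hs'' =>
      ⟨c, hs'', Or.inl (mem_shaft_of_cPref (hF hs') (hprio s'' hs''))⟩)
    exact_mod_cast (Nat.le_add_right (i.q c) (tbar c)).trans hfull
end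

section
/- The capacity-planning mechanism is not student-monotone: there exist an instance Γ = ⟨S, C, ≻, q⟩, a budget B = 1, penalty values, a student s ∈ S, a school c ∈ C, and a modified instance Γ' identical to Γ except that s's position in the priority order ≻_c is improved, such that in every optimal solution (t, μ) of the capacity expansion problem for Γ the student s is assigned a school that s strictly prefers (with respect to ≻_s) to the school assigned to s in every optimal solution (t', μ') of the capacity expansion problem for Γ'. That is, improving a student's priority at a school can strictly worsen that student's assignment. -/
open scoped BigOperators

namespace SchoolInstance

variable {S C : Type*} [Fintype S] [Fintype C]

/-- The objective `Σ_{s∈S} r_{s,μ(s)}`, where `r_{s,c}` is the rank of `c` in `≻_s` for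
assigned students and `rpen s` is the penalty `r_{s,∅}` for unassigned students. -/
noncomputable def ceObjP (i : SchoolInstance S C) (rpen : S → ℝ) (μ : S → Option C) : ℝ :=
  ∑ s, (μ s).elim (rpen s) (fun c => (i.rank s c : ℝ))

/-- `(t,μ)` is feasible for the capacity expansion problem with budget `B`. -/
def ceFeasible (i : SchoolInstance S C) (B : ℕ) (t : C → ℕ) (μ : S → Option C) : Prop :=
  (∑ c, t c) ≤ B ∧ (i.expand t).IsStable μ

/-- `(t,μ)` is an optimal solution of the capacity expansion problem with budget `B`
and penalties `rpen`. -/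
def ceOptimal (i : SchoolInstance S C) (B : ℕ) (rpen : S → ℝ)
    (t : C → ℕ) (μ : S → Option C) : Prop :=
  ceFeasible i B t μ ∧
  ∀ t' μ', ceFeasible i B t' μ' → ceObjP i rpen μ ≤ ceObjP i rpen μ'

end SchoolInstance

open SchoolInstance

namespace SchoolInstance

section Decidability

variable {S C : Type*}

theorem ncard_assignedSet [Fintype S] [DecidableEq C] (μ : S → Option C) (c : C) :
    (assignedSet μ c).ncard = (Finset.univ.filter fun s => μ s = some c).card := by
  rw [← Set.ncard_coe_finset]
  congr 1
  ext s
  simp [assignedSet]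

theorem rank_eq_card [Fintype C] (i : SchoolInstance S C)
    [∀ s c c', Decidable (i.sPref s c c')]
    (s : S) (c : C) :
    i.rank s c = 1 + (Finset.univ.filter fun c' => i.sPref s c' c).card := by
  rw [rank, ← Set.ncard_coe_finset]
  congr 2
  ext s
  simp

instance decidablePrefOver (i : SchoolInstance S C) [∀ s c, Decidable (i.acc s c)]
    [∀ s c c', Decidable (i.sPref s c c')] (s : S) (c : C) :
    (o : Option C) → Decidable (i.prefOver s c o)
  | none => inferInstanceAs (Decidable (i.acc s c))
  | some c' => inferInstanceAs (Decidable (i.sPref s c c'))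

instance decidableNcardLe [Fintype S] [DecidableEq C] (μ : S → Option C) (c : C) (n : ℕ) :
    Decidable ((assignedSet μ c).ncard ≤ n) :=
  decidable_of_iff ((Finset.univ.filter fun s => μ s = some c).card ≤ n)
    (by rw [ncard_assignedSet])

instance decidableNcardLt [Fintype S] [DecidableEq C] (μ : S → Option C) (c : C) (n : ℕ) :
    Decidable ((assignedSet μ c).ncard < n) :=
  decidable_of_iff ((Finset.univ.filter fun s => μ s = some c).card < n)
    (by rw [ncard_assignedSet])

instance decidableIsStable [Fintype S] [Fintype C] [DecidableEq C]
    (i : SchoolInstance S C) [∀ s c, Decidable (i.acc s c)] [∀ s c c', Decidable (i.sPref s c c')]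
    [∀ c s s', Decidable (i.cPref c s s')] :
    DecidablePred i.IsStable := fun μ => by
  unfold IsStable IsMatching IsBlocking
  infer_instance

/-- The objective of the capacity expansion problem for natural number penalties. -/
def objNat [Fintype S] [Fintype C] (i : SchoolInstance S C)
    [∀ s c c', Decidable (i.sPref s c c')] (pen : S → ℕ) (μ : S → Option C) : ℕ :=
  ∑ s, (μ s).elim (pen s) fun c => 1 + (Finset.univ.filter fun c' => i.sPref s c' c).card

theorem ceObjP_natCast [Fintype S] [Fintype C] (i : SchoolInstance S C)
    [∀ s c c', Decidable (i.sPref s c c')] (pen : S → ℕ) (μ : S → Option C) :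
    i.ceObjP (fun s => (pen s : ℝ)) μ = (i.objNat pen μ : ℝ) := by
  rw [ceObjP, objNat, Nat.cast_sum]
  refine Finset.sum_congr rfl fun s _ => ?_
  cases μ s with
  | none => rfl
  | some c => simp only [Option.elim_some, rank_eq_card]

/-- With budget one, it suffices to consider expansions with values in `Fin 2`. -/
theorem forall_ceFeasible_one [Fintype C] {i : SchoolInstance S C}
    {P : (S → Option C) → Prop}
    (h : ∀ (g : C → Fin 2) (μ : S → Option C), ∑ c, (g c : ℕ) ≤ 1 →
      (i.expand fun c => (g c : ℕ)).IsStable μ → P μ)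
    {t : C → ℕ} {μ : S → Option C} (hf : i.ceFeasible 1 t μ) : P μ := by
  have ht : ∀ c, t c < 2 := fun c =>
    Nat.lt_succ_of_le ((Finset.single_le_sum (fun _ _ => Nat.zero_le _)
      (Finset.mem_univ c)).trans hf.1)
  exact h (fun c => ⟨t c, ht c⟩) μ hf.1 hf.2

end Decidability

/-- Two students compete for school `1`, which has the only seat. Student `0` prefers school `0`
to school `1`, student `1` accepts only school `1`, and student `2` accepts only school `2`.
Every school ranks its acceptable students by their value under `σ`, smaller being better. -/
def contested (σ : Equiv.Perm (Fin 3)) : SchoolInstance (Fin 3) (Fin 3) where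
  q := ![0, 1, 0]
  acc s c := s = c ∨ s = 0 ∧ c = 1
  sPref s c c' := (s = c ∨ s = 0 ∧ c = 1) ∧ (s = c' ∨ s = 0 ∧ c' = 1) ∧ c < c'
  cPref c s s' := (s = c ∨ s = 0 ∧ c = 1) ∧ (s' = c ∨ s' = 0 ∧ c = 1) ∧ σ s < σ s'
  sPref_irrefl _ _ h := lt_irrefl _ h.2.2
  sPref_trans _ _ _ _ h h' := ⟨h.1, h'.2.1, h.2.2.trans h'.2.2⟩
  sPref_total _ _ _ h h' hne :=
    (lt_or_gt_of_ne hne).imp (fun hlt => ⟨h, h', hlt⟩) fun hlt => ⟨h', h, hlt⟩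
  sPref_acc _ _ _ h := ⟨h.1, h.2.1⟩
  cPref_irrefl _ _ h := lt_irrefl _ h.2.2
  cPref_trans _ _ _ _ h h' := ⟨h.1, h'.2.1, h.2.2.trans h'.2.2⟩
  cPref_total _ _ _ h h' hne :=
    (lt_or_gt_of_ne (σ.injective.ne hne)).imp (fun hlt => ⟨h, h', hlt⟩) fun hlt => ⟨h', h, hlt⟩
  cPref_acc _ _ _ h := ⟨h.1, h.2.1⟩

section Contested

variable (σ : Equiv.Perm (Fin 3)) (t : Fin 3 → ℕ)

instance (s c : Fin 3) : Decidable ((contested σ).acc s c) := by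
  unfold contested; infer_instance

instance (s c c' : Fin 3) : Decidable ((contested σ).sPref s c c') := by
  unfold contested; infer_instance

instance (c s s' : Fin 3) : Decidable ((contested σ).cPref c s s') := by
  unfold contested; infer_instance

instance (s c : Fin 3) : Decidable (((contested σ).expand t).acc s c) :=
  inferInstanceAs (Decidable ((contested σ).acc s c))

instance (s c c' : Fin 3) : Decidable (((contested σ).expand t).sPref s c c') :=
  inferInstanceAs (Decidable ((contested σ).sPref s c c'))

instance (c s s' : Fin 3) : Decidable (((contested σ).expand t).cPref c s s') :=
  inferInstanceAs (Decidable ((contested σ).cPref c s s'))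

end Contested

/-- If cost `v` is attained by a feasible solution, every feasible solution costs at least `v`,
and those of cost `v` assign `s` to `c`, then optimal solutions exist and all assign `s` to `c`. -/
theorem exists_ceOptimal_and_forall_eq {S C : Type*} [Fintype S] [Fintype C]
    {i : SchoolInstance S C} [∀ s c c', Decidable (i.sPref s c c')] {B : ℕ} {pen : S → ℕ}
    {s : S} {c : C} {v : ℕ} {t : C → ℕ} {μ : S → Option C}
    (hf : i.ceFeasible B t μ) (hv : i.objNat pen μ = v)
    (h : ∀ t' μ', i.ceFeasible B t' μ' →
      v ≤ i.objNat pen μ' ∧ (i.objNat pen μ' ≤ v → μ' s = some c)) :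
    (∃ t μ, ceOptimal i B (fun s => (pen s : ℝ)) t μ) ∧
      ∀ t μ, ceOptimal i B (fun s => (pen s : ℝ)) t μ → μ s = some c := by
  refine ⟨⟨t, μ, hf, fun t' μ' hf' => ?_⟩, fun t' μ' ho => (h t' μ' ho.1).2 ?_⟩
  · rw [ceObjP_natCast, ceObjP_natCast, hv]
    exact_mod_cast (h t' μ' hf').1
  · have := ho.2 t μ hf
    rw [ceObjP_natCast, ceObjP_natCast, hv] at this
    exact_mod_cast this

theorem contested_swap :
    (∃ t μ, ceOptimal (contested (Equiv.swap 0 1)) 1 (fun s => ((![10, 2, 5] s : ℕ) : ℝ)) t μ) ∧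
      ∀ t μ, ceOptimal (contested (Equiv.swap 0 1)) 1 (fun s => ((![10, 2, 5] s : ℕ) : ℝ)) t μ →
        μ 0 = some 0 :=
  exists_ceOptimal_and_forall_eq (v := 7) (t := ![1, 0, 0]) (μ := ![some 0, some 1, none])
    ⟨by decide, by decide⟩ (by decide)
    fun _ _ => forall_ceFeasible_one (P := fun μ => 7 ≤ objNat _ _ μ ∧
      (objNat _ _ μ ≤ 7 → μ 0 = some 0)) (by decide +kernel)

theorem contested_one :
    (∃ t μ, ceOptimal (contested 1) 1 (fun s => ((![10, 2, 5] s : ℕ) : ℝ)) t μ) ∧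
      ∀ t μ, ceOptimal (contested 1) 1 (fun s => ((![10, 2, 5] s : ℕ) : ℝ)) t μ →
        μ 0 = some 1 :=
  exists_ceOptimal_and_forall_eq (v := 5) (t := ![0, 0, 1]) (μ := ![some 1, none, some 2])
    ⟨by decide, by decide⟩ (by decide)
    fun _ _ => forall_ceFeasible_one (P := fun μ => 5 ≤ objNat _ _ μ ∧
      (objNat _ _ μ ≤ 5 → μ 0 = some 1)) (by decide +kernel)

end SchoolInstance

/-- The capacity-planning mechanism is not student-monotone: there are an
instance `Γ`, budget `B = 1`, penalties, a student `s`, a school `c`, and a modified instance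
`Γ'` identical to `Γ` except that `s`'s position in the priority order `≻_c` is improved,
such that `s` is assigned a school `c₁` in every optimal solution for `Γ`, a school `c₂` in
every optimal solution for `Γ'`, and `s` strictly prefers `c₁` to `c₂`. -/
theorem not_student_monotone :
    ∃ (nS nC : ℕ) (i i' : SchoolInstance (Fin nS) (Fin nC)) (rpen : Fin nS → ℝ)
      (s : Fin nS) (c : Fin nC),
      i'.q = i.q ∧
      i'.acc = i.acc ∧
      i'.sPref = i.sPref ∧
      (∀ c', c' ≠ c → i'.cPref c' = i.cPref c') ∧
      (∀ s₁ s₂, s₁ ≠ s → s₂ ≠ s → (i'.cPref c s₁ s₂ ↔ i.cPref c s₁ s₂)) ∧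
      (∀ s', i'.cPref c s' s → i.cPref c s' s) ∧
      (∃ s', i.cPref c s' s ∧ i'.cPref c s s') ∧
      (∃ t μ, ceOptimal i 1 rpen t μ) ∧
      (∃ t' μ', ceOptimal i' 1 rpen t' μ') ∧
      ∃ c₁ c₂ : Fin nC,
        (∀ t μ, ceOptimal i 1 rpen t μ → μ s = some c₁) ∧
        (∀ t' μ', ceOptimal i' 1 rpen t' μ' → μ' s = some c₂) ∧
        i.sPref s c₁ c₂ := by
  refine ⟨3, 3, contested (Equiv.swap 0 1), contested 1, fun s => ((![10, 2, 5] s : ℕ) : ℝ), 0, 1,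
    rfl, rfl, rfl, fun c' hc' => ?_, by decide, by decide, by decide, contested_swap.1,
    contested_one.1, 0, 1, contested_swap.2, contested_one.2, by decide⟩
  funext s s'
  have h : ∀ c' s s', c' ≠ 1 →
      ((contested 1).cPref c' s s' ↔ (contested (Equiv.swap 0 1)).cPref c' s s') := by decide
  exact propext (h c' s s' hc')
end
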